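/- Let u₁, u₂, v₁, v₂ ∈ ℂ and let R be a ℂ-linear endomorphism of ℂ[z₁,z₂] such that (i) R commutes with multiplication by z₁, and (ii) R (L₁(u₁,u₂) + L₂(v₁,v₂)) = (L₁(v₁,u₂) + L₂(u₁,v₂)) R as 2×2 matrices of operators (i.e., four entrywise operator identities). Then R satisfies the second-order defining equation R L₁(u₁,u₂) L₂(v₁,v₂) = L₁(v₁,u₂) L₂(u₁,v₂) R. -/

import Mathlib

open MvPolynomial

/-- Multiplication by `zᵢ` on `ℂ[z₁,z₂]` (indices `0,1` for `1,2`). -/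
noncomputable def Zm (i : Fin 2) : Module.End ℂ (MvPolynomial (Fin 2) ℂ) :=
  LinearMap.mulLeft ℂ (X i)

/-- Partial derivative `∂ᵢ = ∂/∂zᵢ` on `ℂ[z₁,z₂]`. -/
noncomputable def Dm (i : Fin 2) : Module.End ℂ (MvPolynomial (Fin 2) ℂ) :=
  (pderiv i).toLinearMap

/-- The `sl(2)` Lax matrix `Lᵢ(a,b) = [[a + zᵢ∂ᵢ, −∂ᵢ], [zᵢ²∂ᵢ + (a−b)zᵢ, b − zᵢ∂ᵢ]]`. -/
noncomputable def Lax (i : Fin 2) (a b : ℂ) :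
    Matrix (Fin 2) (Fin 2) (Module.End ℂ (MvPolynomial (Fin 2) ℂ)) :=
  !![a • 1 + Zm i * Dm i, -Dm i;
     Zm i * Zm i * Dm i + (a - b) • Zm i, b • 1 - Zm i * Dm i]

/-- The scalar 2×2 matrix `R·Id`. -/
noncomputable def SM (R : Module.End ℂ (MvPolynomial (Fin 2) ℂ)) :
    Matrix (Fin 2) (Fin 2) (Module.End ℂ (MvPolynomial (Fin 2) ℂ)) :=
  Matrix.scalar (Fin 2) R

section WeylRelations

theorem Dm_mul_Zm_self (i : Fin 2) : Dm i * Zm i = Zm i * Dm i + 1 := by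
  refine LinearMap.ext fun f => ?_
  simp [Dm, Zm, add_comm]

theorem Dm_mul_Zm_of_ne {i j : Fin 2} (h : j ≠ i) : Dm i * Zm j = Zm j * Dm i := by
  refine LinearMap.ext fun f => ?_
  simp [Dm, Zm, pderiv_X_of_ne h]

theorem Zm_mul_comm (i j : Fin 2) : Zm i * Zm j = Zm j * Zm i := by
  refine LinearMap.ext fun f => ?_
  simp [Zm, mul_left_comm]

/-- Left multiplication by the operator `z₂ - z₁` is injective. -/
theorem Zm_sub_mul_left_cancel {S T : Module.End ℂ (MvPolynomial (Fin 2) ℂ)}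
    (h : (Zm 1 - Zm 0) * S = (Zm 1 - Zm 0) * T) : S = T := by
  have hX : (X 1 - X 0 : MvPolynomial (Fin 2) ℂ) ≠ 0 :=
    sub_ne_zero.2 fun h => by simpa using X_injective h
  refine LinearMap.ext fun f => ?_
  have hf := LinearMap.congr_fun h f
  simp only [Zm, Module.End.mul_apply, LinearMap.sub_apply, LinearMap.mulLeft_apply,
    ← sub_mul] at hf
  exact mul_left_cancel₀ hX hf

end WeylRelations

section Factorization

/-- The unipotent matrix `[[1, 0], [x, 1]]`. -/
def lowerUnipotent {A : Type*} [Ring A] (x : A) : Matrix (Fin 2) (Fin 2) A := !![1, 0; x, 1]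

theorem lowerUnipotent_neg_mul {A : Type*} [Ring A] (x : A) :
    lowerUnipotent (-x) * lowerUnipotent x = 1 := by
  simp [lowerUnipotent, Matrix.one_fin_two]

theorem scalar_mul_lowerUnipotent {A : Type*} [Ring A] {R x : A} (h : R * x = x * R) :
    Matrix.scalar (Fin 2) R * lowerUnipotent x =
      lowerUnipotent x * Matrix.scalar (Fin 2) R := by
  ext i j
  fin_cases i <;> fin_cases j <;> simp [lowerUnipotent, h]

variable {A : Type*} [Ring A] [Algebra ℂ A]

/-- The upper triangular matrix `[[a - 1, -p], [0, b]]`, a conjugate of the Lax matrix. -/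
def triangularLax (p : A) (a b : ℂ) : Matrix (Fin 2) (Fin 2) A :=
  !![(a - 1) • 1, -p; 0, b • 1]

/-- The Lax matrix with position operator `w` and momentum operator `q`. -/
def laxOf (w q : A) (a b : ℂ) : Matrix (Fin 2) (Fin 2) A :=
  !![a • 1 + w * q, -q; w * w * q + (a - b) • w, b • 1 - w * q]

theorem laxOf_eq_conj_triangularLax {x p : A} (h : p * x = x * p + 1) (a b : ℂ) :
    laxOf x p a b = lowerUnipotent x * triangularLax p a b * lowerUnipotent (-x) := by
  ext i j
  fin_cases i <;> fin_cases j <;>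
  · simp [laxOf, lowerUnipotent, triangularLax, mul_add, add_mul, mul_assoc, h]
    try module

/-- Translating the position operator conjugates the Lax matrix by a unipotent matrix. -/
theorem laxOf_eq_conj_laxOf_sub {x y q : A} (h : q * x = x * q) (hxy : y * x = x * y)
    (a b : ℂ) :
    laxOf y q a b = lowerUnipotent x * laxOf (y - x) q a b * lowerUnipotent (-x) := by
  have hxy' (S : A) : y * (x * S) = x * (y * S) := by
    rw [← mul_assoc, hxy, mul_assoc]
  ext i j
  fin_cases i <;> fin_cases j <;>
  · simp [laxOf, lowerUnipotent, mul_add, add_mul, mul_sub, sub_mul, mul_assoc, h, hxy, hxy']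
    try module

end Factorization

section Intertwining

variable {A : Type*} [Ring A] [Algebra ℂ A]

/-- If `R` commutes with `w * q` and intertwines the lower left entries of two Lax matrices,
then it intertwines `(w * q + u - v₂) * q` with `(w * q + v₁ - v₂) * q`. -/
theorem intertwine_momentum {R w q : A} {u v₁ v₂ : ℂ}
    (hw : ∀ {S T : A}, w * S = w * T → S = T) (hqw : q * w = w * q + 1)
    (hN : R * (w * q) = w * q * R)
    (hC : R * (w * (w * q + (v₁ - v₂) • 1)) = w * (w * q + (u - v₂) • 1) * R) :
    R * ((w * q + (u - v₂) • 1) * q) = (w * q + (v₁ - v₂) • 1) * q * R := by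
  apply hw
  have hNu : R * (w * q + (u - v₂) • 1) = (w * q + (u - v₂) • 1) * R := by
    simp [mul_add, add_mul, hN]
  have hwN (c : ℂ) : w * (w * q + c • 1) * q = (w * q + (c - 1) • 1) * (w * q) := by
    have : w * q * (w * q) = w * (w * q) * q + w * q := by
      rw [mul_assoc w q (w * q), ← mul_assoc q w q, hqw]
      noncomm_ring
    simp only [add_mul, mul_add, this, smul_mul_assoc, mul_smul_comm, one_mul, mul_one]
    module
  calc w * (R * ((w * q + (u - v₂) • 1) * q))
      = w * (w * q + (u - v₂) • 1) * R * q := by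
        rw [← mul_assoc R, hNu]; simp only [mul_assoc]
    _ = R * (w * (w * q + (v₁ - v₂) • 1) * q) := by rw [← hC, mul_assoc]
    _ = (w * q + (v₁ - v₂ - 1) • 1) * (w * q) * R := by
        have hc : R * (w * q + (v₁ - v₂ - 1) • 1) = (w * q + (v₁ - v₂ - 1) • 1) * R := by
          simp [mul_add, add_mul, hN]
        rw [hwN, ← mul_assoc R, hc, mul_assoc, hN, ← mul_assoc]
    _ = w * ((w * q + (v₁ - v₂) • 1) * q * R) := by
        rw [← hwN]; simp only [mul_assoc]

theorem intertwine_triangularLax_mul_laxOf {R w q p : A} {u₁ u₂ v₁ v₂ : ℂ}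
    (hw : ∀ {S T : A}, w * S = w * T → S = T) (hqw : q * w = w * q + 1)
    (hP : R * (p + q) = (p + q) * R) (hN : R * (w * q) = w * q * R)
    (hC : R * (w * (w * q + (v₁ - v₂) • 1)) = w * (w * q + (u₁ - v₂) • 1) * R) :
    Matrix.scalar (Fin 2) R * (triangularLax p u₁ u₂ * laxOf w q v₁ v₂) =
      triangularLax p v₁ u₂ * laxOf w q u₁ v₂ * Matrix.scalar (Fin 2) R := by
  have hq := intertwine_momentum hw hqw hN hC
  obtain ⟨P, rfl⟩ : ∃ P, p = P - q := ⟨p + q, by simp⟩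
  rw [sub_add_cancel] at hP
  have hR : Matrix.scalar (Fin 2) R = !![R, 0; 0, R] := by
    ext i j; fin_cases i <;> fin_cases j <;> simp
  rw [hR]
  have hlower (c : ℂ) : w * w * q + (c - v₂) • w = w * (w * q + (c - v₂) • 1) := by
    simp [mul_add, mul_assoc]
  have hqN : q * (w * q) = w * q * q + q := by
    rw [← mul_assoc, hqw, add_mul, one_mul]
  have hqC (c : ℂ) :
      q * (w * (w * q + c • 1)) = w * q * (w * q) + (c + 1) • (w * q) + c • 1 := by
    rw [← mul_assoc, hqw]
    simp only [add_mul, mul_add, mul_smul_comm, one_mul, mul_one]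
    module
  have hNN : R * (w * q * (w * q)) = w * q * (w * q) * R := by
    rw [← mul_assoc, hN, mul_assoc, hN, mul_assoc (w * q) (w * q)]
  have hqCv := hqC (v₁ - v₂)
  have hqCu := hqC (u₁ - v₂)
  simp only [triangularLax, laxOf, Matrix.mul_fin_two, hlower]
  generalize w * (w * q + (v₁ - v₂) • 1) = Cv at *
  generalize w * (w * q + (u₁ - v₂) • 1) = Cu at *
  generalize w * q = N at *
  have hPC : R * (P * Cv) = P * Cu * R := by
    rw [← mul_assoc, hP, mul_assoc, hC, mul_assoc P]
  have hPN : R * (P * N) = P * N * R := by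
    rw [← mul_assoc, hP, mul_assoc, hN, mul_assoc P]
  simp only [add_mul, mul_add, one_mul, smul_mul_assoc, mul_smul_comm] at hq
  ext i j
  fin_cases i <;> fin_cases j <;>
    simp [mul_add, add_mul, mul_sub, sub_mul, hP, hN, hC, hqN, hqCv, hqCu, hNN, hPC, hPN]
  · module
  · linear_combination (norm := module) -hq

/-- The first-order system in terms of the relative position `y - x`. -/
theorem first_order_reduction {R x y p q : A} {u₁ u₂ v₁ v₂ : ℂ}
    (hx : R * x = x * R) (hxy : y * x = x * y)
    (hL : Matrix.scalar (Fin 2) R * (laxOf x p u₁ u₂ + laxOf y q v₁ v₂) =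
      (laxOf x p v₁ u₂ + laxOf y q u₁ v₂) * Matrix.scalar (Fin 2) R) :
    R * (p + q) = (p + q) * R ∧ R * ((y - x) * q) = (y - x) * q * R ∧
      R * ((y - x) * ((y - x) * q + (v₁ - v₂) • 1)) =
        (y - x) * ((y - x) * q + (u₁ - v₂) • 1) * R := by
  have h₀₀ := congrFun₂ hL 0 0
  have h₀₁ := congrFun₂ hL 0 1
  have h₁₀ := congrFun₂ hL 1 0
  simp [laxOf, mul_add, add_mul] at h₀₀ h₀₁ h₁₀
  have hP : R * (p + q) = (p + q) * R := by
    rw [mul_add, add_mul]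
    linear_combination (norm := module) -h₀₁
  have hxP : R * (x * (p + q)) = x * (p + q) * R := by
    rw [← mul_assoc, hx, mul_assoc, hP, mul_assoc x]
  have hxxP : R * (x * (x * (p + q))) = x * (x * (p + q)) * R := by
    rw [← mul_assoc, hx, mul_assoc, hxP, ← mul_assoc x]
  have hN : R * ((y - x) * q) = (y - x) * q * R := by
    simp only [mul_add, add_mul, sub_mul, mul_sub] at hxP ⊢
    linear_combination (norm := module) h₀₀ - hxP
  have hxN : R * (x * ((y - x) * q)) = x * ((y - x) * q) * R := by
    rw [← mul_assoc, hx, mul_assoc, hN, mul_assoc x]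
  refine ⟨hP, hN, ?_⟩
  have hxy' (S : A) : y * (x * S) = x * (y * S) := by
    rw [← mul_assoc, hxy, mul_assoc]
  simp only [mul_add, add_mul, sub_mul, mul_sub, mul_assoc, hxy', mul_smul_comm, mul_one,
    smul_mul_assoc, smul_sub] at hxxP hxN h₁₀ ⊢
  simp only [hx] at h₁₀ ⊢
  linear_combination (norm := module) h₁₀ - hxxP - (2 : ℂ) • hxN

end Intertwining

/-- If `R` commutes with multiplication by `z₁` and satisfies the first-order system
`R (L₁(u₁,u₂) + L₂(v₁,v₂)) = (L₁(v₁,u₂) + L₂(u₁,v₂)) R`, then `R` satisfies the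
second-order defining equation `R L₁(u₁,u₂) L₂(v₁,v₂) = L₁(v₁,u₂) L₂(u₁,v₂) R`. -/
theorem R1_first_order_implies_second_order (u₁ u₂ v₁ v₂ : ℂ)
    (R : Module.End ℂ (MvPolynomial (Fin 2) ℂ))
    (hz : R * Zm 0 = Zm 0 * R)
    (hL : SM R * (Lax 0 u₁ u₂ + Lax 1 v₁ v₂) = (Lax 0 v₁ u₂ + Lax 1 u₁ v₂) * SM R) :
    SM R * (Lax 0 u₁ u₂ * Lax 1 v₁ v₂) = Lax 0 v₁ u₂ * Lax 1 u₁ v₂ * SM R := by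
  have hD := Dm_mul_Zm_of_ne (i := 1) (j := 0) (by decide)
  have hlax (i : Fin 2) (a b : ℂ) : Lax i a b = laxOf (Zm i) (Dm i) a b := rfl
  have hfirst (a b : ℂ) := laxOf_eq_conj_triangularLax (Dm_mul_Zm_self 0) a b
  have hsecond (a b : ℂ) := laxOf_eq_conj_laxOf_sub hD (Zm_mul_comm 1 0) a b
  have hqw : Dm 1 * (Zm 1 - Zm 0) = (Zm 1 - Zm 0) * Dm 1 + 1 := by
    rw [mul_sub, sub_mul, hD, Dm_mul_Zm_self]
    abel
  obtain ⟨hP, hN, hC⟩ := first_order_reduction hz (Zm_mul_comm 1 0) hL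
  have hTK := intertwine_triangularLax_mul_laxOf (u₂ := u₂) Zm_sub_mul_left_cancel hqw hP hN hC
  have hM := scalar_mul_lowerUnipotent hz
  have hM' := scalar_mul_lowerUnipotent (Commute.neg_right hz).eq
  have hprod (a b c d : ℂ) : Lax 0 a b * Lax 1 c d = lowerUnipotent (Zm 0) *
      (triangularLax (Dm 0) a b * laxOf (Zm 1 - Zm 0) (Dm 1) c d) *
        lowerUnipotent (-Zm 0) := by
    rw [hlax, hlax, hfirst, hsecond]
    simp only [mul_assoc]
    rw [← mul_assoc (lowerUnipotent (-Zm 0)) (lowerUnipotent (Zm 0)), lowerUnipotent_neg_mul,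
      one_mul]
  rw [hprod, hprod, SM, mul_assoc _ _ (Matrix.scalar (Fin 2) R), ← hM', ← mul_assoc,
    ← mul_assoc, hM, mul_assoc (lowerUnipotent (Zm 0)), hTK]
  simp only [mul_assoc]
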